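/- Characterization of 1-generic points: A point p ∈ ℕ^ℕ is 1-generic if and only if every limit computable partial function F :⊆ ℕ^ℕ → ℕ^ℕ with p ∈ dom(F) is continuous at p. -/

import Mathlib

open scoped Classical

namespace LimitComp

/-- Baire space `ℕ^ℕ`. -/
abbrev Baire : Type := ℕ → ℕ

/-- The finite prefix of length `k` of a point of Baire space. -/
def pre (p : Baire) (k : ℕ) : List ℕ := List.ofFn fun i : Fin k => p i

/-- Interleaving pairing `⟨q,p⟩(2n) = q(n)`, `⟨q,p⟩(2n+1) = p(n)`. -/
def pairB (q p : Baire) : Baire := fun n => if n % 2 = 0 then q (n / 2) else p (n / 2)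

/-- The `i`-th component of a tupling `⟨p₀,p₁,p₂,...⟩`. -/
def seqOf (p : Baire) (i : ℕ) : Baire := fun n => p (Nat.pair i n)

/-- Tupling `⟨p₀,p₁,p₂,...⟩` of a sequence of points of Baire space. -/
def tup (ps : ℕ → Baire) : Baire := fun m => ps m.unpair.1 m.unpair.2

/-- The limit map `lim :⊆ ℕ^ℕ → ℕ^ℕ`; it maps `⟨p₀,p₁,p₂,...⟩` to its pointwise
limit, which is defined whenever every coordinate is eventually constant. -/
noncomputable def limB : Baire →. Baire := fun p =>
  ⟨∀ n, ∃ i₀, ∀ i, i₀ ≤ i → seqOf p i n = seqOf p i₀ n,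
   fun h n => seqOf p (Classical.choose (h n)) n⟩

/-- Monotonicity of a finite approximation function under prefix extension
(this corresponds to a one-way output tape). -/
def PrefixMono (η : List ℕ → ℕ → Option ℕ) : Prop :=
  ∀ u v n y, u <+: v → η u n = some y → η v n = some y

/-- `η` approximates the partial function `F`: for every input in the domain of `F`
every output position is eventually filled with the correct output value. -/
def OneWayApprox (η : List ℕ → ℕ → Option ℕ) (F : Baire →. Baire) : Prop :=
  ∀ p q, q ∈ F p → ∀ n, ∃ k, η (pre p k) n = some (q n)

/-- Computability for partial functions on Baire space: `F` is computed by a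
Turing machine with one-way output tape, formalized via a computable monotone
finite approximation function. -/
def ComputableFn (F : Baire →. Baire) : Prop :=
  ∃ η : List ℕ → ℕ → Option ℕ, Computable₂ η ∧ PrefixMono η ∧ OneWayApprox η F

/-- `η` is a limit approximation of `F`: on every input in the domain of `F`,
every output cell eventually stabilizes to the correct output value. -/
def LimitApprox (η : List ℕ → ℕ → ℕ) (F : Baire →. Baire) : Prop :=
  ∀ p q, q ∈ F p → ∀ n, ∃ k₀, ∀ k, k₀ ≤ k → η (pre p k) n = q n

/-- Limit computability for partial functions on Baire space: `F` is computed by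
a Turing machine with a two-way output tape such that on inputs in the domain
every output cell eventually stabilizes. -/
def LimitComputableFn (F : Baire →. Baire) : Prop :=
  ∃ η : List ℕ → ℕ → ℕ, Computable₂ η ∧ LimitApprox η F

/-- The `i`-th Turing machine halts on input `p ∈ ℕ^ℕ` (i.e. it halts after
having read some finite prefix of `p`). -/
def haltsOn (i : ℕ) (p : Baire) : Prop :=
  ∃ k, ((Denumerable.ofNat Nat.Partrec.Code i).eval (Encodable.encode (pre p k))).Dom

/-- The Turing jump operator `J : ℕ^ℕ → ℕ^ℕ`. -/
noncomputable def jump (p : Baire) : Baire := fun i => if haltsOn i p then 1 else 0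

/-- The halting problem `0'`. -/
noncomputable def zero' : Baire := jump fun _ => 0

/-- `F` is computable relative to the oracle `q`. -/
def ComputableRel (q : Baire) (F : Baire →. Baire) : Prop :=
  ∃ G : Baire →. Baire, ComputableFn G ∧ ∀ p r, r ∈ F p → r ∈ G (pairB q p)

/-- `F` is limit computable relative to the oracle `q`. -/
def LimitComputableRel (q : Baire) (F : Baire →. Baire) : Prop :=
  ∃ G : Baire →. Baire, LimitComputableFn G ∧ ∀ p r, r ∈ F p → r ∈ G (pairB q p)

/-- Turing reducibility for points of Baire space. -/
def TuringLe (p q : Baire) : Prop :=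
  ∃ F : Baire →. Baire, ComputableFn F ∧ p ∈ F q

end LimitComp

namespace LimitComp

/-- Continuity of a partial function on Baire space at a point `p` of its domain. -/
def ContAtB (F : Baire →. Baire) (p : Baire) : Prop :=
  ∀ q, q ∈ F p → ∀ n : ℕ, ∃ m : ℕ, ∀ p' q', q' ∈ F p' → pre p' m = pre p m → q' n = q n

/-- A point `p ∈ ℕ^ℕ` is 1-generic if the Turing jump `J` is continuous at `p`. -/
noncomputable def OneGeneric (p : Baire) : Prop := ContinuousAt jump p

theorem length_pre (p : Baire) (k : ℕ) : (pre p k).length = k := by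
  simp [pre]

theorem take_pre (p : Baire) {j k : ℕ} (h : j ≤ k) : (pre p k).take j = pre p j := by
  apply List.ext_getElem <;> simp [pre, h]

theorem pre_eq_iff {p p' : Baire} {m : ℕ} : pre p' m = pre p m ↔ ∀ i < m, p' i = p i := by
  simp only [pre, List.ofFn_inj, funext_iff, Fin.forall_iff]

/-- The cylinders determined by the prefixes of `p` form a neighbourhood basis at `p`. -/
theorem hasBasis_nhds_pre (p : Baire) :
    (nhds p).HasBasis (fun _ : ℕ => True) fun m => {p' | pre p' m = pre p m} := by
  refine ⟨fun t => ?_⟩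
  have h : ∀ x m, PiNat.cylinder (E := fun _ : ℕ => ℕ) x m = {p' : Baire | pre p' m = pre x m} :=
    fun x m => Set.ext fun p' => by simp [PiNat.cylinder, pre_eq_iff]
  rw [(PiNat.isTopologicalBasis_cylinders fun _ => ℕ).mem_nhds_iff]
  constructor
  · rintro ⟨_, ⟨x, m, rfl⟩, hp, ht⟩
    rw [← PiNat.mem_cylinder_iff_eq.1 hp, h] at ht
    exact ⟨m, trivial, ht⟩
  · rintro ⟨m, -, ht⟩
    exact ⟨_, ⟨p, m, rfl⟩, PiNat.self_mem_cylinder _ _, (h p m).trans_subset ht⟩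

theorem continuousAt_jump_iff (p : Baire) :
    ContinuousAt jump p ↔ ∀ i, ∃ m, ∀ p', pre p' m = pre p m → jump p' i = jump p i := by
  rw [continuousAt_pi]
  refine forall_congr' fun i => ?_
  rw [ContinuousAt, nhds_discrete ℕ, Filter.tendsto_pure, (hasBasis_nhds_pre p).eventually_iff]
  simp only [true_and, Set.mem_ofPred_eq]

theorem haltsOn_iff_of_jump_eq {p p' : Baire} {i : ℕ} (h : jump p' i = jump p i) :
    haltsOn i p' ↔ haltsOn i p := by
  by_cases hp : haltsOn i p <;> by_cases hp' : haltsOn i p' <;> simp_all [jump]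

/-- Every computable property of finite prefixes is semi-decided by some Turing machine. -/
theorem exists_haltsOn_iff {P : List ℕ → Prop} (hP : ComputablePred P) :
    ∃ i, ∀ p, haltsOn i p ↔ ∃ k, P (pre p k) := by
  obtain ⟨c, hc⟩ := Nat.Partrec.Code.exists_code.1 hP.to_re
  refine ⟨Encodable.encode c, fun p => exists_congr fun k => ?_⟩
  rw [Denumerable.ofNat_encode, hc]
  simp [Part.assert]

/-- The value of the jump at `i` guessed from the finite prefix `u`, running the `i`-th machine
for `u.length` steps on all prefixes of `u`. -/
noncomputable def jumpApprox (u : List ℕ) (i : ℕ) : ℕ :=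
  if ∃ k < u.length + 1, ((Nat.Partrec.Code.evaln u.length (Denumerable.ofNat _ i)
    (Encodable.encode (u.take k))).isSome : Prop) then 1 else 0

theorem computable_jumpApprox : Computable₂ jumpApprox := by
  have hR : PrimrecRel fun (k : ℕ) (a : List ℕ × ℕ) =>
      ((Nat.Partrec.Code.evaln a.1.length (Denumerable.ofNat _ a.2)
        (Encodable.encode (a.1.take k))).isSome : Prop) := by
    refine Primrec.primrecPred (p := fun x : ℕ × (List ℕ × ℕ) => _) ?_
    simp only [Bool.decide_eq_true]
    refine Primrec.option_isSome.comp (Nat.Partrec.Code.primrec_evaln.comp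
      (g := fun x : ℕ × (List ℕ × ℕ) => ((x.2.1.length, Denumerable.ofNat _ x.2.2),
        Encodable.encode (x.2.1.take x.1))) (.pair (.pair ?_ ?_) ?_))
    · exact Primrec.list_length.comp (Primrec.fst.comp Primrec.snd)
    · exact (Primrec.ofNat _).comp (Primrec.snd.comp Primrec.snd)
    · exact Primrec.encode.comp (Primrec.list_take.comp Primrec.fst (Primrec.fst.comp Primrec.snd))
  have hS : PrimrecPred fun a : List ℕ × ℕ => ∃ k < a.1.length + 1,
      ((Nat.Partrec.Code.evaln a.1.length (Denumerable.ofNat _ a.2)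
        (Encodable.encode (a.1.take k))).isSome : Prop) :=
    (hR.exists_mem_list.comp (Primrec.list_range.comp
      (Primrec.succ.comp (Primrec.list_length.comp Primrec.fst))) Primrec.id).of_eq (by simp)
  exact (Primrec.ite hS (Primrec.const 1) (Primrec.const 0)).to_comp

theorem jumpApprox_pre (p : Baire) (i : ℕ) :
    ∃ k₀, ∀ k, k₀ ≤ k → jumpApprox (pre p k) i = jump p i := by
  by_cases h : haltsOn i p
  · obtain ⟨j, hj⟩ := h
    obtain ⟨x, hx⟩ := Part.dom_iff_mem.1 hj
    obtain ⟨s, hs⟩ := Nat.Partrec.Code.evaln_complete.1 hx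
    refine ⟨max j s, fun k hk => ?_⟩
    have h : haltsOn i p := ⟨j, hj⟩
    rw [jump, if_pos h, jumpApprox, if_pos]
    have hjk : j ≤ k := (le_max_left _ _).trans hk
    refine ⟨j, by rw [length_pre]; omega, ?_⟩
    rw [take_pre p hjk, length_pre]
    exact Option.isSome_iff_exists.2
      ⟨x, Nat.Partrec.Code.evaln_mono ((le_max_right _ _).trans hk) hs⟩
  · refine ⟨0, fun k _ => ?_⟩
    rw [jump, if_neg h, jumpApprox, if_neg]
    rintro ⟨j, hj, hs⟩
    rw [length_pre] at hj hs
    rw [take_pre p (by omega)] at hs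
    obtain ⟨x, hx⟩ := Option.isSome_iff_exists.1 hs
    exact h ⟨j, Part.dom_iff_mem.2 ⟨x, Nat.Partrec.Code.evaln_sound hx⟩⟩

/-- The Turing jump is limit computable. -/
theorem limitComputableFn_jump : LimitComputableFn fun p => Part.some (jump p) := by
  refine ⟨jumpApprox, computable_jumpApprox, fun p q hq n => ?_⟩
  rw [Part.mem_some_iff.1 hq]
  exact jumpApprox_pre p n

/-- Past stage `k₀`, disagreement of a computable approximation with a fixed value is decidable. -/
theorem computablePred_disagree {η : List ℕ → ℕ → ℕ} (hη : Computable₂ η) (n v k₀ : ℕ) :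
    ComputablePred fun u : List ℕ => k₀ ≤ u.length ∧ η u n ≠ v := by
  refine ⟨inferInstance, ((Primrec.and.to_comp).comp
    ((Primrec.nat_le.decide.to_comp).comp (Computable.const k₀) Computable.list_length)
    (Primrec.not.to_comp.comp ((Primrec.eq.decide.to_comp).comp
      (hη.comp Computable.id (Computable.const n)) (Computable.const v)))).of_eq fun u => ?_⟩
  simp

/-- **Characterization of 1-generic points.** A point `p ∈ ℕ^ℕ` is 1-generic if
and only if every limit computable partial function `F :⊆ ℕ^ℕ → ℕ^ℕ` with
`p ∈ dom F` is continuous at `p`. -/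
theorem one_generic_characterization (p : Baire) :
    OneGeneric p ↔
      ∀ F : Baire →. Baire, LimitComputableFn F → (F p).Dom → ContAtB F p := by
  rw [OneGeneric]
  constructor
  · rintro hp F ⟨η, hη, hF⟩ - q hq n
    obtain ⟨k₀, hk₀⟩ := hF p q hq n
    obtain ⟨i, hi⟩ := exists_haltsOn_iff (computablePred_disagree hη n (q n) k₀)
    obtain ⟨m, hm⟩ := (continuousAt_jump_iff p).1 hp i
    have hpi : ¬ haltsOn i p := by
      rw [hi]
      rintro ⟨k, hk, hne⟩
      exact hne (hk₀ k (by rwa [length_pre] at hk))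
    refine ⟨m, fun p' q' hq' hpre => ?_⟩
    obtain ⟨k₁, hk₁⟩ := hF p' q' hq' n
    by_contra hne
    refine hpi ((haltsOn_iff_of_jump_eq (hm p' hpre)).1 ((hi p').2 ⟨max k₀ k₁, ?_, ?_⟩))
    · rw [length_pre]
      exact le_max_left _ _
    · rwa [hk₁ _ (le_max_right _ _)]
  · intro h
    refine (continuousAt_jump_iff p).2 fun i => ?_
    obtain ⟨m, hm⟩ := h _ limitComputableFn_jump trivial _ (Part.mem_some _) i
    exact ⟨m, fun p' hp' => hm p' _ (Part.mem_some _) hp'⟩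

end LimitComp
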